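/- arXiv:1905.02118 — 3 statements merged into one kernel-verified Lean document; each statement's English description precedes it below -/
import Mathlib

section
/- For every finite abstract simplicial complex G, the inequality (dim(G)+1)/2 ≤ Dim⁺(G) holds between the augmented inductive dimension and the average simplex cardinality. -/
/-- A finite abstract simplicial complex: a finite collection of nonempty finite
subsets of the vertex type `V`, closed under taking nonempty subsets. -/
def IsComplex {V : Type*} [DecidableEq V] (G : Finset (Finset V)) : Prop :=
  (∀ x ∈ G, x.Nonempty) ∧ ∀ x ∈ G, ∀ y ⊆ x, y.Nonempty → y ∈ G

/-- The average simplex cardinality `Dim⁺(G) = (∑_{x ∈ G} |x|) / (|G| + 1)`. -/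
def DimPlus {V : Type*} [DecidableEq V] (G : Finset (Finset V)) : ℚ :=
  (∑ x ∈ G, (x.card : ℚ)) / (G.card + 1)

/-- The unit sphere `S(x) = {y ∈ G : y ⊊ x or x ⊊ y}` of `x` in `G`. -/
def sphere {V : Type*} [DecidableEq V] (G : Finset (Finset V)) (x : Finset V) :
    Finset (Finset V) :=
  G.filter fun y => y ⊂ x ∨ x ⊂ y

/-- The inductive dimension: `dim ∅ = -1` and
`dim G = 1 + (1/|G|)·∑_{x ∈ G} dim (S(x))` for nonempty `G`. -/
def indDim {V : Type*} [DecidableEq V] (G : Finset (Finset V)) : ℚ :=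
  if G.Nonempty then
    1 + (∑ x ∈ G.attach, indDim (sphere G x.1)) / G.card
  else -1
termination_by G.card
decreasing_by
  refine Finset.card_lt_card ⟨Finset.filter_subset _ _, fun hsub => ?_⟩
  have h := hsub x.2
  simp only [sphere, Finset.mem_filter] at h
  rcases h.2 with h' | h' <;> exact ssubset_irrefl _ h'

/-- The strict upper set of `x` in `G`; it is isomorphic to the link of `x`. -/
def properStar {V : Type*} [DecidableEq V] (G : Finset (Finset V)) (x : Finset V) :
    Finset (Finset V) :=
  G.filter fun y => x ⊂ y

section

variable {V : Type*} [DecidableEq V]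

theorem mem_properStar {G : Finset (Finset V)} {x y : Finset V} :
    y ∈ properStar G x ↔ y ∈ G ∧ x ⊂ y := by
  simp [properStar]

theorem notMem_properStar (G : Finset (Finset V)) (x : Finset V) : x ∉ properStar G x := by
  simp [properStar]

theorem indDim_empty : indDim (∅ : Finset (Finset V)) = -1 := by
  rw [indDim]; simp

theorem card_mul_indDim (G : Finset (Finset V)) :
    (G.card : ℚ) * indDim G = ∑ x ∈ G, (indDim (sphere G x) + 1) := by
  rcases G.eq_empty_or_nonempty with rfl | h
  · simp
  · have hc : (G.card : ℚ) ≠ 0 := by simpa using h.ne_empty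
    rw [indDim, if_pos h, Finset.sum_attach G fun x => indDim (sphere G x),
      Finset.sum_add_distrib]
    field_simp
    simp [add_comm]

theorem card_sphere_lt {G : Finset (Finset V)} {x : Finset V} (hx : x ∈ G) :
    (sphere G x).card < G.card := by
  refine Finset.card_lt_card (Finset.filter_ssubset.2 ⟨x, hx, ?_⟩)
  simp

/-- The augmented inductive dimension is additive under ordinal sums. -/
theorem indDim_union (A B : Finset (Finset V)) (h : ∀ a ∈ A, ∀ b ∈ B, a ⊂ b) :
    indDim (A ∪ B) + 1 = (indDim A + 1) + (indDim B + 1) := by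
  induction hn : A.card + B.card using Nat.strong_induction_on generalizing A B with
  | _ n ih =>
  subst hn
  rcases (A ∪ B).eq_empty_or_nonempty with he | hne
  · obtain ⟨rfl, rfl⟩ := Finset.union_eq_empty.1 he
    simp [indDim_empty]
  have hd : Disjoint A B :=
    Finset.disjoint_left.2 fun a ha hb => ssubset_irrefl a (h a ha a hb)
  have hA : ∀ a ∈ A, indDim (sphere (A ∪ B) a) + 1
      = (indDim (sphere A a) + 1) + (indDim B + 1) := by
    intro a ha
    have hs : sphere (A ∪ B) a = sphere A a ∪ B := by
      ext y
      simp only [sphere, Finset.mem_filter, Finset.mem_union]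
      have := h a ha y
      tauto
    rw [hs]
    refine ih _ (by have := card_sphere_lt ha; omega) _ _ (fun y hy => ?_) rfl
    exact h y (Finset.mem_filter.1 hy).1
  have hB : ∀ b ∈ B, indDim (sphere (A ∪ B) b) + 1
      = (indDim A + 1) + (indDim (sphere B b) + 1) := by
    intro b hb
    have hs : sphere (A ∪ B) b = A ∪ sphere B b := by
      ext y
      simp only [sphere, Finset.mem_filter, Finset.mem_union]
      have := fun hy => h y hy b hb
      tauto
    rw [hs]
    refine ih _ (by have := card_sphere_lt hb; omega) _ _ (fun y hy z hz => ?_) rfl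
    exact h y hy z (Finset.mem_filter.1 hz).1
  have key := card_mul_indDim (A ∪ B)
  rw [Finset.sum_union hd, Finset.sum_congr rfl hA, Finset.sum_congr rfl hB,
    Finset.sum_add_distrib (f := fun a => indDim (sphere A a) + 1),
    Finset.sum_add_distrib (g := fun b => indDim (sphere B b) + 1),
    ← card_mul_indDim, ← card_mul_indDim, Finset.card_union_of_disjoint hd] at key
  simp only [Finset.sum_const, nsmul_eq_mul, Nat.cast_add] at key
  have hc : (A.card + B.card : ℚ) ≠ 0 := by
    rw [← Nat.cast_add, ← Finset.card_union_of_disjoint hd]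
    simpa using hne.ne_empty
  apply mul_left_cancel₀ hc
  linear_combination key

/-- An open interval of a Boolean lattice has the dimension of a sphere. -/
theorem indDim_Ioo {x y : Finset V} (hxy : x ⊂ y) :
    indDim (Finset.Ioo x y) + 1 = (y.card : ℚ) - x.card - 1 := by
  induction hn : (Finset.Ioo x y).card using Nat.strong_induction_on generalizing x y with
  | _ n ih =>
  subst hn
  rcases (Finset.Ioo x y).eq_empty_or_nonempty with he | hne
  · have hcov : x ⋖ y :=
      ⟨hxy, fun z hxz hzy => Finset.notMem_empty z (he ▸ Finset.mem_Ioo.2 ⟨hxz, hzy⟩)⟩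
    have hc : y.card = x.card + 1 :=
      (Nat.covBy_iff_add_one_eq.1 (hcov.card_finset)).symm
    rw [he, indDim_empty, hc]
    push_cast; ring
  have hs : ∀ z ∈ Finset.Ioo x y, indDim (sphere (Finset.Ioo x y) z) + 1
      = (y.card : ℚ) - x.card - 2 := by
    intro z hz
    obtain ⟨hxz, hzy⟩ := Finset.mem_Ioo.1 hz
    have hlt := card_sphere_lt hz
    have hs : sphere (Finset.Ioo x y) z = Finset.Ioo x z ∪ Finset.Ioo z y := by
      ext w
      simp only [sphere, Finset.mem_filter, Finset.mem_union, Finset.mem_Ioo]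
      constructor
      · rintro ⟨⟨h1, h2⟩, h3 | h3⟩
        · exact Or.inl ⟨h1, h3⟩
        · exact Or.inr ⟨h3, h2⟩
      · rintro (⟨h1, h2⟩ | ⟨h1, h2⟩)
        · exact ⟨⟨h1, h2.trans hzy⟩, Or.inl h2⟩
        · exact ⟨⟨hxz.trans h1, h2⟩, Or.inr h1⟩
    rw [hs] at hlt ⊢
    rw [indDim_union _ _ fun a ha b hb =>
        (Finset.mem_Ioo.1 ha).2.trans (Finset.mem_Ioo.1 hb).1,
      ih _ ((Finset.card_le_card Finset.subset_union_left).trans_lt hlt) hxz rfl,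
      ih _ ((Finset.card_le_card Finset.subset_union_right).trans_lt hlt) hzy rfl]
    ring
  have key := card_mul_indDim (Finset.Ioo x y)
  rw [Finset.sum_congr rfl hs, Finset.sum_const, nsmul_eq_mul] at key
  have hc : ((Finset.Ioo x y).card : ℚ) ≠ 0 := by simpa using hne.ne_empty
  rw [mul_left_cancel₀ hc key]
  ring

theorem IsComplex.mem_of_ssubset_of_subset {G : Finset (Finset V)} (hG : IsComplex G)
    {x y z : Finset V} (hy : y ∈ G) (hxz : x ⊂ z) (hzy : z ⊆ y) : z ∈ G :=
  hG.2 y hy z hzy (Finset.empty_ssubset.1 ((Finset.empty_subset x).trans_ssubset hxz))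

theorem IsComplex.card_mul_indDim_properStar {G : Finset (Finset V)} (hG : IsComplex G)
    (x : Finset V) :
    ((properStar G x).card : ℚ) * (indDim (properStar G x) + 1)
      = ∑ z ∈ properStar G x, (((z \ x).card : ℚ) + (indDim (properStar G z) + 1)) := by
  rw [mul_add, card_mul_indDim, mul_one, Finset.cast_card, ← Finset.sum_add_distrib]
  refine Finset.sum_congr rfl fun z hz => ?_
  obtain ⟨hzG, hxz⟩ := mem_properStar.1 hz
  have hs : sphere (properStar G x) z = Finset.Ioo x z ∪ properStar G z := by
    ext w
    simp only [sphere, Finset.mem_filter, Finset.mem_union, Finset.mem_Ioo, mem_properStar]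
    constructor
    · rintro ⟨⟨h1, h2⟩, h3 | h3⟩
      · exact Or.inl ⟨h2, h3⟩
      · exact Or.inr ⟨h1, h3⟩
    · rintro (⟨h1, h2⟩ | ⟨h1, h2⟩)
      · exact ⟨⟨hG.mem_of_ssubset_of_subset hzG h1 h2.subset, h1⟩, Or.inl h2⟩
      · exact ⟨⟨h1, hxz.trans h2⟩, Or.inr h2⟩
  rw [hs, indDim_union _ _ fun a ha b hb =>
      (Finset.mem_Ioo.1 ha).2.trans (mem_properStar.1 hb).2, indDim_Ioo hxz,
    Finset.card_sdiff_of_subset hxz.subset, Nat.cast_sub (Finset.card_le_card hxz.subset)]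
  ring

theorem sum_card_sdiff_eq_sum_card_filter (S : Finset (Finset V)) (x W : Finset V)
    (hW : ∀ y ∈ S, y ⊆ W) :
    ∑ y ∈ S, (y \ x).card = ∑ v ∈ W, (S.filter fun y => v ∈ y \ x).card := by
  refine Eq.trans ?_ (Finset.sum_card_bipartiteAbove_eq_sum_card_bipartiteBelow
    fun (y : Finset V) v => v ∈ y \ x)
  refine Finset.sum_congr rfl fun y hy => congrArg _ ?_
  ext v
  simp only [Finset.bipartiteAbove, Finset.mem_filter]
  exact ⟨fun h => ⟨hW y hy (Finset.mem_sdiff.1 h).1, h⟩, fun h => h.2⟩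

/-- At most half of the simplices containing `z` contain a given vertex outside `z`. -/
theorem IsComplex.two_mul_card_filter_properStar_le {G : Finset (Finset V)} (hG : IsComplex G)
    (z : Finset V) (v : V) :
    2 * ((properStar G z).filter fun y => v ∈ y \ z).card
      ≤ ((properStar G z).card + 1) * if v ∉ z ∧ insert v z ∈ G then 1 else 0 := by
  set A := (properStar G z).filter fun y => v ∈ y \ z with hA
  have memA : ∀ y, y ∈ A ↔ (y ∈ G ∧ z ⊂ y) ∧ v ∈ y ∧ v ∉ z := fun y => by
    rw [hA, Finset.mem_filter, mem_properStar, Finset.mem_sdiff]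
  split_ifs with hv
  · have hle : A.card ≤ (insert z (properStar G z) \ A).card := by
      refine Finset.card_le_card_of_injOn (fun y => y.erase v) ?_ ?_
      · intro y hy
        obtain ⟨⟨hyG, hzy⟩, hvy, hvz⟩ := (memA y).1 hy
        have hsub : z ⊆ y.erase v := Finset.subset_erase.2 ⟨hzy.subset, hvz⟩
        simp only [Finset.coe_sdiff, Set.mem_sdiff, Finset.mem_coe, memA, Finset.mem_insert,
          mem_properStar]
        refine ⟨?_, fun h => Finset.notMem_erase v y h.2.1⟩
        rcases hsub.eq_or_ssubset with h | h
        · exact Or.inl h.symm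
        · exact Or.inr ⟨hG.mem_of_ssubset_of_subset hyG h (Finset.erase_subset _ _), h⟩
      · intro y hy y' hy' h
        rw [← Finset.insert_erase ((memA y).1 hy).2.1,
          ← Finset.insert_erase ((memA y').1 hy').2.1]
        exact congrArg _ h
    have hsub : A ⊆ insert z (properStar G z) :=
      (Finset.filter_subset _ _).trans (Finset.subset_insert _ _)
    rw [Finset.card_sdiff_of_subset hsub,
      Finset.card_insert_of_notMem (notMem_properStar G z)] at hle
    have := Finset.card_le_card (Finset.filter_subset (fun y => v ∈ y \ z) (properStar G z))
    omega
  · have hempty : A = ∅ := by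
      refine Finset.eq_empty_of_forall_notMem fun y hy => hv ?_
      obtain ⟨⟨hyG, hzy⟩, hvy, hvz⟩ := (memA y).1 hy
      exact ⟨hvz, hG.mem_of_ssubset_of_subset hyG (Finset.ssubset_insert hvz)
        (Finset.insert_subset hvy hzy.subset)⟩
    simp [hempty]

/-- On average over the simplices containing `x`, links have at most half the average simplex
cardinality of the link of `x`. -/
theorem IsComplex.sum_average_properStar_le {G : Finset (Finset V)} (hG : IsComplex G)
    (x : Finset V) :
    ∑ z ∈ insert x (properStar G x),
        ((∑ y ∈ properStar G z, (y \ z).card : ℕ) : ℚ) / ((properStar G z).card + 1)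
      ≤ ((∑ y ∈ properStar G x, (y \ x).card : ℕ) : ℚ) / 2 := by
  set W := G.sup id
  have hW : ∀ z, ∀ y ∈ properStar G z, y ⊆ W := fun z y hy =>
    Finset.le_sup (f := id) (mem_properStar.1 hy).1
  set c : Finset V → V → ℕ := fun z v => if v ∉ z ∧ insert v z ∈ G then 1 else 0
  have hterm : ∀ z ∈ insert x (properStar G x),
      ((∑ y ∈ properStar G z, (y \ z).card : ℕ) : ℚ) / ((properStar G z).card + 1)
        ≤ ((∑ v ∈ W, c z v : ℕ) : ℚ) / 2 := by
    intro z _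
    have h : 2 * ∑ y ∈ properStar G z, (y \ z).card
        ≤ ((properStar G z).card + 1) * ∑ v ∈ W, c z v := by
      rw [sum_card_sdiff_eq_sum_card_filter _ z W (hW z), Finset.mul_sum, Finset.mul_sum]
      exact Finset.sum_le_sum fun v _ => hG.two_mul_card_filter_properStar_le z v
    rw [div_le_div_iff₀ (by positivity) (by norm_num), mul_comm, mul_comm (Nat.cast _)]
    exact_mod_cast h
  have hcount : ∑ z ∈ insert x (properStar G x), ∑ v ∈ W, c z v
      ≤ ∑ y ∈ properStar G x, (y \ x).card := by
    rw [sum_card_sdiff_eq_sum_card_filter _ x W (hW x), Finset.sum_comm]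
    refine Finset.sum_le_sum fun v _ => ?_
    rw [← Finset.card_filter]
    refine Finset.card_le_card_of_injOn (insert v) ?_ ?_
    · intro z hz
      obtain ⟨hz, hvz, hvG⟩ := Finset.mem_filter.1 hz
      have hxz : x ⊆ z := by
        rcases Finset.mem_insert.1 hz with rfl | h
        · rfl
        · exact (mem_properStar.1 h).2.subset
      refine Finset.mem_filter.2 ⟨mem_properStar.2
        ⟨hvG, hxz.trans_ssubset (Finset.ssubset_insert hvz)⟩, ?_⟩
      exact Finset.mem_sdiff.2 ⟨Finset.mem_insert_self _ _, fun h => hvz (hxz h)⟩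
    · intro z hz z' hz' h
      have h1 := (Finset.mem_filter.1 hz).2.1
      have h2 := (Finset.mem_filter.1 hz').2.1
      rw [← Finset.erase_insert h1, ← Finset.erase_insert h2]
      exact congrArg (fun s => s.erase v) h
  refine (Finset.sum_le_sum hterm).trans ?_
  rw [← Finset.sum_div, ← Nat.cast_sum]
  gcongr

theorem IsComplex.indDim_properStar_le {G : Finset (Finset V)} (hG : IsComplex G)
    (x : Finset V) :
    indDim (properStar G x) + 1
      ≤ 2 * (((∑ y ∈ properStar G x, (y \ x).card : ℕ) : ℚ) / ((properStar G x).card + 1)) := by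
  induction hn : (properStar G x).card using Nat.strong_induction_on generalizing x with
  | _ n ih =>
  subst hn
  rcases (properStar G x).eq_empty_or_nonempty with he | hne
  · simp [he, indDim_empty]
  have hih : ∀ z ∈ properStar G x, indDim (properStar G z) + 1
      ≤ 2 * (((∑ y ∈ properStar G z, (y \ z).card : ℕ) : ℚ) / ((properStar G z).card + 1)) := by
    intro z hz
    refine ih _ (Finset.card_lt_card ⟨fun y hy => ?_, fun h => ?_⟩) z rfl
    · rw [mem_properStar] at hy hz ⊢
      exact ⟨hy.1, hz.2.trans hy.2⟩
    · exact notMem_properStar G z (h hz)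
  have hrec := hG.card_mul_indDim_properStar x
  rw [Finset.sum_add_distrib, ← Nat.cast_sum] at hrec
  have hsum := Finset.sum_le_sum hih
  rw [← Finset.mul_sum] at hsum
  have havg := hG.sum_average_properStar_le x
  rw [Finset.sum_insert (notMem_properStar G x)] at havg
  have hc : (0 : ℚ) < (properStar G x).card := by exact_mod_cast hne.card_pos
  refine le_of_mul_le_mul_left ?_ hc
  have hsplit (T m : ℚ) (hm : 0 < m) : m * (2 * (T / (m + 1))) = 2 * T - 2 * (T / (m + 1)) := by
    field_simp
    ring
  rw [hsplit _ _ hc]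
  linarith

end

/-- For every finite abstract simplicial complex `G`, the augmented inductive
dimension and the average simplex cardinality satisfy `(dim(G)+1)/2 ≤ Dim⁺(G)`. -/
theorem half_indDim_le_DimPlus {V : Type*} [DecidableEq V] (G : Finset (Finset V))
    (hG : IsComplex G) :
    (indDim G + 1) / 2 ≤ DimPlus G := by
  have hstar : properStar G ∅ = G :=
    Finset.filter_true_of_mem fun y hy => Finset.empty_ssubset.2 (hG.1 y hy)
  have h := hG.indDim_properStar_le ∅
  simp only [hstar, Finset.sdiff_empty, Nat.cast_sum] at h
  rw [DimPlus]
  linarith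
end

section
/- For finite abstract simplicial complexes G and H on disjoint vertex sets, the genus is multiplicative under the join: 1 − χ(G ⊕ H) = (1 − χ(G))·(1 − χ(H)). -/
/-- The join `G ⊕ H` of two simplicial complexes. -/
def joinC {V : Type*} [DecidableEq V] (G H : Finset (Finset V)) : Finset (Finset V) :=
  G ∪ H ∪ (G ×ˢ H).image fun p => p.1 ∪ p.2

/-- The Euler characteristic `χ(G) = ∑_{x ∈ G} (-1)^{|x|-1}`. -/
def eulerChar {V : Type*} [DecidableEq V] (G : Finset (Finset V)) : ℤ :=
  ∑ x ∈ G, (-1 : ℤ) ^ (x.card - 1)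

theorem Finset.subset_of_union_eq_union {V : Type*} [DecidableEq V] {a b c d : Finset V}
    (had : Disjoint a d) (h : a ∪ b = c ∪ d) : a ⊆ c :=
  had.left_le_of_le_sup_right (Finset.subset_union_left.trans h.subset)

theorem injOn_union_of_disjoint {V : Type*} [DecidableEq V] {G H : Finset (Finset V)}
    (hdisj : ∀ x ∈ G, ∀ y ∈ H, Disjoint x y) :
    Set.InjOn (fun p : Finset V × Finset V => p.1 ∪ p.2) (G ×ˢ H : Finset _) := by
  rintro ⟨a, b⟩ hab ⟨c, d⟩ hcd h
  simp only [Finset.coe_product, Set.mem_prod, Finset.mem_coe] at hab hcd h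
  have h' : b ∪ a = d ∪ c := by rw [Finset.union_comm b, h, Finset.union_comm]
  have had := hdisj a hab.1 d hcd.2
  have hcb := hdisj c hcd.1 b hab.2
  exact Prod.ext
    ((Finset.subset_of_union_eq_union had h).antisymm
      (Finset.subset_of_union_eq_union hcb h.symm))
    ((Finset.subset_of_union_eq_union hcb.symm h').antisymm
      (Finset.subset_of_union_eq_union had.symm h'.symm))

theorem neg_one_pow_card_union_sub_one {V : Type*} [DecidableEq V] {x y : Finset V}
    (hx : x.Nonempty) (hy : y.Nonempty) (hxy : Disjoint x y) :
    (-1 : ℤ) ^ ((x ∪ y).card - 1) = -((-1) ^ (x.card - 1) * (-1) ^ (y.card - 1)) := by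
  have hx := hx.card_pos
  have hy := hy.card_pos
  rw [Finset.card_union_of_disjoint hxy,
    show x.card + y.card - 1 = (x.card - 1) + (y.card - 1) + 1 by omega]
  ring

/-- The genus `1 - χ` is multiplicative under the join of simplicial complexes
on disjoint vertex sets: `1 - χ(G ⊕ H) = (1 - χ(G))·(1 - χ(H))`. -/
theorem genus_joinC {V : Type*} [DecidableEq V] (G H : Finset (Finset V))
    (hG : IsComplex G) (hH : IsComplex H)
    (hdisj : ∀ x ∈ G, ∀ y ∈ H, Disjoint x y) :
    1 - eulerChar (joinC G H) = (1 - eulerChar G) * (1 - eulerChar H) := by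
  have hGH : Disjoint G H := Finset.disjoint_left.2 fun x hx hx' =>
    (hG.1 x hx).ne_empty (disjoint_self.1 (hdisj x hx x hx'))
  have hjoin : Disjoint (G ∪ H) ((G ×ˢ H).image fun p => p.1 ∪ p.2) := by
    rw [Finset.disjoint_right]
    intro z hz hz'
    obtain ⟨⟨x, y⟩, hxy, rfl⟩ := Finset.mem_image.1 hz
    obtain ⟨hx, hy⟩ := Finset.mem_product.1 hxy
    rcases Finset.mem_union.1 hz' with h | h
    · exact (hH.1 y hy).ne_empty
        (disjoint_self.1 ((hdisj _ h y hy).mono_left Finset.subset_union_right))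
    · exact (hG.1 x hx).ne_empty
        (disjoint_self.1 ((hdisj x hx _ h).mono_right Finset.subset_union_left))
  have hprod : ∑ z ∈ (G ×ˢ H).image (fun p => p.1 ∪ p.2), (-1 : ℤ) ^ (z.card - 1) =
      -(eulerChar G * eulerChar H) := by
    rw [Finset.sum_image (injOn_union_of_disjoint hdisj), eulerChar, eulerChar,
      Finset.sum_mul_sum, ← Finset.sum_product', ← Finset.sum_neg_distrib]
    refine Finset.sum_congr rfl fun p hp => ?_
    obtain ⟨hx, hy⟩ := Finset.mem_product.1 hp
    exact neg_one_pow_card_union_sub_one (hG.1 _ hx) (hH.1 _ hy) (hdisj _ hx _ hy)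
  have hsum : eulerChar (joinC G H) =
      eulerChar G + eulerChar H - eulerChar G * eulerChar H := by
    rw [eulerChar, joinC, Finset.sum_union hjoin, Finset.sum_union hGH, hprod]
    simp only [eulerChar]
    ring
  rw [hsum]
  ring
end

section
/- Fix d ≥ 1 and let A be the (d+1)×(d+1) matrix with entries A_{i,k} equal to the number of surjective functions from a (k+1)-element set onto an (i+1)-element set, and let v be the unique vector with positive entries summing to 1 satisfying A·v = (d+1)!·v. Then the Barycentric limit constant C_d = Σ_{k=0}^d (k+1)·v_k is a rational number and satisfies (d+1)/2 < C_d < d+1. -/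
/-- The number of surjective functions from an `m`-element set onto a
`k`-element set. -/
def surjCount (m k : ℕ) : ℕ :=
  Fintype.card {f : Fin m → Fin k // Function.Surjective f}

/-- The Barycentric refinement operator in maximal dimension `d`: the
`(d+1)×(d+1)` matrix whose `(i,k)` entry is the number of surjections from a
`(k+1)`-element set onto an `(i+1)`-element set. -/
noncomputable def baryOp (d : ℕ) : Matrix (Fin (d + 1)) (Fin (d + 1)) ℝ :=
  Matrix.of fun i k => (surjCount ((k : ℕ) + 1) ((i : ℕ) + 1) : ℝ)

open Finset in
theorem card_filter_image_eq_surjCount {k m : ℕ} (s : Finset (Fin m)) :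
    #{f : Fin k → Fin m | univ.image f = s} = surjCount k #s := by
  classical
  rw [← Fintype.card_subtype, surjCount]
  have e := s.equivFin
  refine Fintype.card_congr
    { toFun := fun f => ⟨fun x => e ⟨f.1 x, (Finset.ext_iff.1 f.2 _).1 (mem_image_of_mem _ (mem_univ x))⟩, fun y => ?_⟩
      invFun := fun g => ⟨fun x => (e.symm (g.1 x)).1, ?_⟩
      left_inv := fun f => by ext; simp
      right_inv := fun g => by ext; simp }
  · obtain ⟨x, -, hx⟩ := mem_image.1 ((Finset.ext_iff.1 f.2 _).2 (e.symm y).2)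
    exact ⟨x, by simp [hx]⟩
  · ext y
    simp only [mem_image, mem_univ, true_and]
    constructor
    · rintro ⟨x, rfl⟩
      exact (e.symm (g.1 x)).2
    · intro hy
      obtain ⟨x, hx⟩ := g.2 (e ⟨y, hy⟩)
      exact ⟨x, by simp [hx]⟩

theorem surjCount_eq_zero_of_lt {m k : ℕ} (h : m < k) : surjCount m k = 0 := by
  rw [surjCount, Fintype.card_eq_zero_iff]
  refine ⟨fun f => ?_⟩
  have := Fintype.card_le_of_surjective f.1 f.2
  simp at this
  omega

theorem surjCount_succ_zero (m : ℕ) : surjCount (m + 1) 0 = 0 := by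
  rw [surjCount, Fintype.card_eq_zero_iff]
  exact ⟨fun f => (f.1 0).elim0⟩

theorem surjCount_self (k : ℕ) : surjCount k k = k.factorial := by
  classical
  rw [surjCount, ← Fintype.card_fin k, ← Fintype.card_perm, Fintype.card_fin]
  exact Fintype.card_congr
    { toFun := fun f => Equiv.ofBijective f.1 (Finite.surjective_iff_bijective.1 f.2)
      invFun := fun e => ⟨e, e.surjective⟩
      left_inv := fun f => rfl
      right_inv := fun e => by ext; rfl }

theorem sum_surjCount_mul_choose (m k : ℕ) :
    ∑ i ∈ Finset.range (k + 1), surjCount k i * m.choose i = m ^ k := by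
  classical
  have h1 : m ^ k = ∑ i ∈ Finset.range (m + 1), surjCount k i * m.choose i := by
    have h := Finset.card_eq_sum_card_fiberwise
      (f := fun f : Fin k → Fin m => Finset.univ.image f) (s := Finset.univ)
      (t := (Finset.univ : Finset (Fin m)).powerset) (fun f _ => by simp)
    simp only [card_filter_image_eq_surjCount] at h
    rw [Finset.sum_powerset_apply_card (fun c => surjCount k c)] at h
    simpa [mul_comm] using h
  rw [h1]
  trans ∑ i ∈ Finset.range (m + k + 1), surjCount k i * m.choose i
  · refine Finset.sum_subset (fun i hi => by simp at hi ⊢; omega) fun i _ hi => ?_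
    rw [surjCount_eq_zero_of_lt (by simpa using hi), zero_mul]
  · refine (Finset.sum_subset (fun i hi => by simp at hi ⊢; omega) fun i _ hi => ?_).symm
    rw [Nat.choose_eq_zero_of_lt (by simpa using hi), mul_zero]

/-- The functions `ℕ → ℝ` whose generating function is `H(x) / (1 - x) ^ (n + 1)` for a polynomial
`H` of degree at most `n` with nonnegative coefficients of sum `n!`. -/
def HasNonnegNumerator (n : ℕ) (f : ℕ → ℝ) : Prop :=
  ∃ c : ℕ → ℝ, (∀ j, 0 ≤ c j) ∧ (∀ j, n < j → c j = 0) ∧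
    ∑ j ∈ Finset.range (n + 1), c j = n.factorial ∧
    ∀ m : ℕ, f m = ∑ j ∈ Finset.range (n + 1), c j * (m + n - j).choose n

theorem HasNonnegNumerator.cast_add_mul {n : ℕ} {f : ℕ → ℝ} (hf : HasNonnegNumerator n f) {e : ℕ}
    (he : e ≤ 1) : HasNonnegNumerator (n + 1) (fun m => ((m : ℝ) + e) * f m) := by
  obtain ⟨c, hc, hc', hs, hm⟩ := hf
  have he' : (e : ℝ) ≤ 1 := by exact_mod_cast he
  have key (K : ℕ → ℝ) : ∑ j ∈ Finset.range (n + 1 + 1), ((j + e) * c j +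
      j.casesOn 0 fun i => ((n : ℝ) + 1 - e - i) * c i) * K j =
      ∑ j ∈ Finset.range (n + 1), c j * ((j + e) * K j + (n + 1 - e - j) * K (j + 1)) := by
    rw [Finset.sum_congr rfl fun j _ => add_mul ((j + e) * c j) _ (K j), Finset.sum_add_distrib,
      Finset.sum_congr rfl fun j _ => mul_add (c j) ((j + e) * K j) _, Finset.sum_add_distrib]
    congr 1
    · rw [Finset.sum_range_succ, hc' (n + 1) (by omega), mul_zero, zero_mul, add_zero]
      exact Finset.sum_congr rfl fun j _ => by ring
    · rw [Finset.sum_range_succ']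
      refine (add_eq_left.2 (zero_mul (K 0))).trans ?_
      exact Finset.sum_congr rfl fun j _ => by ring
  refine ⟨fun j => (j + e) * c j + j.casesOn 0 fun i => ((n : ℝ) + 1 - e - i) * c i,
    fun j => ?_, fun j hj => ?_, ?_, fun m => ?_⟩
  · have := hc j
    refine add_nonneg (by positivity) ?_
    rcases j with _ | i
    · exact le_rfl
    · rcases le_or_gt i n with hi | hi
      · have : (i : ℝ) ≤ n := by exact_mod_cast hi
        exact mul_nonneg (by linarith) (hc i)
      · simp [hc' i hi]
  · rcases j with _ | i
    · omega
    · simp [hc' i (by omega), hc' (i + 1) (by omega)]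
  · have := key 1
    simp only [Pi.one_apply, mul_one] at this
    rw [this, Nat.factorial_succ]
    push_cast
    rw [← hs, Finset.mul_sum]
    exact Finset.sum_congr rfl fun j _ => by ring
  · simp only [key fun j => ((m + (n + 1) - j).choose (n + 1) : ℝ), hm m, Finset.mul_sum]
    refine Finset.sum_congr rfl fun j hj => ?_
    have hj : j ≤ n := by simpa [Nat.lt_succ_iff] using hj
    obtain ⟨N, hN⟩ : ∃ N, N + j = m + n := ⟨m + n - j, by omega⟩
    rw [show m + n - j = N by omega, show m + (n + 1) - j = N + 1 by omega,
      show m + (n + 1) - (j + 1) = N by omega]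
    have h1 : ((N + 1).choose (n + 1) : ℝ) = N.choose n + N.choose (n + 1) := by
      exact_mod_cast Nat.choose_succ_succ N n
    have h2 : (N.choose (n + 1) : ℝ) * (n + 1) = N.choose n * (N - n) := by
      rcases le_or_gt n N with h | h
      · rw [← Nat.cast_sub h]
        exact_mod_cast Nat.choose_succ_right_eq N n
      · rw [Nat.choose_eq_zero_of_lt h, Nat.choose_eq_zero_of_lt (by omega : N < n + 1)]
        simp
    have h3 : (m : ℝ) = N + j - n := by
      have : (N : ℝ) + j = m + n := by exact_mod_cast hN
      linarith
    rw [h1, h3]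
    linear_combination -c j * h2

theorem hasNonnegNumerator_pow_mul_pow (a b : ℕ) :
    HasNonnegNumerator (a + b) (fun m => (m : ℝ) ^ a * (m + 1) ^ b) := by
  induction a with
  | zero =>
    induction b with
    | zero =>
      refine ⟨fun j => if j = 0 then 1 else 0, fun j => ?_, fun j hj => ?_, ?_, fun m => ?_⟩
      · positivity
      · simp [show j ≠ 0 by omega]
      · simp
      · simp
    | succ b ih =>
      have h := ih.cast_add_mul (le_refl 1)
      refine (funext fun m => ?_ : (fun m : ℕ => (m : ℝ) ^ 0 * ((m : ℝ) + 1) ^ (b + 1)) = _) ▸ h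
      push_cast
      ring
  | succ a ih =>
    rw [show a + 1 + b = a + b + 1 by ring]
    have h := ih.cast_add_mul (Nat.zero_le 1)
    refine (funext fun m => ?_ : (fun m : ℕ => (m : ℝ) ^ (a + 1) * ((m : ℝ) + 1) ^ b) = _) ▸ h
    push_cast
    ring

/-- A nonnegative square matrix all of whose columns sum to `s` has a nonnegative eigenvector with
eigenvalue `s`. -/
theorem exists_nonneg_eigenvector_of_col_sum_eq {ι : Type*} [Fintype ι] [Nonempty ι]
    {M : Matrix ι ι ℝ} {s : ℝ} (hM : ∀ i j, 0 ≤ M i j) (hs : ∀ j, ∑ i, M i j = s) :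
    ∃ h : ι → ℝ, (∀ i, 0 ≤ h i) ∧ h ≠ 0 ∧ M.mulVec h = s • h := by
  classical
  have hdet : (M - s • (1 : Matrix ι ι ℝ)).det = 0 := by
    rw [← Matrix.exists_vecMul_eq_zero_iff]
    refine ⟨1, one_ne_zero, ?_⟩
    ext j
    simp [Matrix.vecMul, dotProduct, hs, Matrix.one_apply]
  obtain ⟨h, h0, hh⟩ := Matrix.exists_mulVec_eq_zero_iff.2 hdet
  have hh : M.mulVec h = s • h := by
    rw [Matrix.sub_mulVec, Matrix.smul_mulVec, Matrix.one_mulVec, sub_eq_zero] at hh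
    exact hh
  have hs0 : 0 ≤ s := by
    obtain ⟨j⟩ := ‹Nonempty ι›
    exact hs j ▸ Finset.sum_nonneg fun i _ => hM i j
  refine ⟨fun i => |h i|, fun i => abs_nonneg _, fun H => h0 ?_, ?_⟩
  · ext i
    simpa using congrFun H i
  · have hle : ∀ i ∈ Finset.univ, s * |h i| ≤ ∑ j, M i j * |h j| := fun i _ => by
      have := congrFun hh i
      simp only [Matrix.mulVec, dotProduct, Pi.smul_apply, smul_eq_mul] at this
      rw [← abs_of_nonneg hs0, ← abs_mul, ← this]
      refine (Finset.abs_sum_le_sum_abs _ _).trans_eq (Finset.sum_congr rfl fun j _ => ?_)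
      rw [abs_mul, abs_of_nonneg (hM i j)]
    have hsum : ∑ i, s * |h i| = ∑ i, ∑ j, M i j * |h j| := by
      rw [Finset.sum_comm]
      simp [← Finset.sum_mul, hs]
    ext i
    exact ((Finset.sum_eq_sum_iff_of_le hle).1 hsum i (Finset.mem_univ i)).symm

/-- The coefficient of `t ^ k` in `∑ j ≤ n, h j * t ^ j * (1 + t) ^ (n - j)`. -/
noncomputable def fVector (n : ℕ) (h : ℕ → ℝ) (k : ℕ) : ℝ :=
  ∑ j ∈ Finset.range (n + 1), h j * if j ≤ k then ((n - j).choose (k - j) : ℝ) else 0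

theorem sum_fVector_mul (n : ℕ) (h F : ℕ → ℝ) :
    ∑ k ∈ Finset.range (n + 1), fVector n h k * F k =
      ∑ j ∈ Finset.range (n + 1), h j *
        ∑ l ∈ Finset.range (n - j + 1), ((n - j).choose l : ℝ) * F (j + l) := by
  simp only [fVector, Finset.sum_mul]
  rw [Finset.sum_comm]
  refine Finset.sum_congr rfl fun j hj => ?_
  have hj : j ≤ n := by simpa [Nat.lt_succ_iff] using hj
  simp only [mul_assoc, ← Finset.mul_sum]
  congr 1
  rw [show n + 1 = j + (n - j + 1) by omega, Finset.sum_range_add, Finset.sum_eq_zero, zero_add]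
  · refine Finset.sum_congr rfl fun l _ => ?_
    rw [if_pos (by omega), Nat.add_sub_cancel_left]
  · intro k hk
    rw [if_neg (by simpa using hk), zero_mul]

theorem sum_fVector_mul_pow (n : ℕ) (h : ℕ → ℝ) (x : ℝ) :
    ∑ k ∈ Finset.range (n + 1), fVector n h k * x ^ k =
      ∑ j ∈ Finset.range (n + 1), h j * (x ^ j * (x + 1) ^ (n - j)) := by
  rw [sum_fVector_mul]
  refine Finset.sum_congr rfl fun j _ => ?_
  congr 1
  rw [add_pow, Finset.mul_sum]
  simp only [one_pow, mul_one]
  exact Finset.sum_congr rfl fun l _ => by rw [pow_add]; ring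

theorem sum_fVector_mul_choose (n : ℕ) (h : ℕ → ℝ) (m : ℕ) :
    ∑ k ∈ Finset.range (n + 1), fVector n h k * m.choose k =
      ∑ j ∈ Finset.range (n + 1), h j * (m + n - j).choose n := by
  rw [sum_fVector_mul n h fun k => (m.choose k : ℝ)]
  refine Finset.sum_congr rfl fun j hj => ?_
  have hj : j ≤ n := by simpa [Nat.lt_succ_iff] using hj
  congr 1
  rw [show m + n - j = (n - j) + m by omega, Nat.add_choose_eq,
    Finset.Nat.sum_antidiagonal_eq_sum_range_succ_mk]
  push_cast
  rw [show n.succ = (n - j + 1) + j by omega, Finset.sum_range_add _ (n - j + 1) j,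
    Finset.sum_eq_zero (s := Finset.range j), add_zero,
    ← Finset.sum_range_reflect _ (n - j + 1)]
  · refine Finset.sum_congr rfl fun l hl => ?_
    have hl : l ≤ n - j := by simpa [Nat.lt_succ_iff] using hl
    rw [show n - j + 1 - 1 - l = n - j - l by omega, Nat.choose_symm hl]
    congr 3
    omega
  · intro l _
    rw [Nat.choose_eq_zero_of_lt (by omega : n - j < n - j + 1 + l)]
    simp

theorem sum_fVector_mul_two_mul_sub (n : ℕ) (h : ℕ → ℝ) :
    ∑ k ∈ Finset.range (n + 1), fVector n h k * (2 * k - n) =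
      ∑ j ∈ Finset.range (n + 1), h j * (j * 2 ^ (n - j)) := by
  rw [sum_fVector_mul n h fun k => (2 * k - n : ℝ)]
  refine Finset.sum_congr rfl fun j hj => ?_
  have hj : j ≤ n := by simpa [Nat.lt_succ_iff] using hj
  congr 1
  obtain ⟨N, rfl⟩ := Nat.exists_eq_add_of_le hj
  rw [Nat.add_sub_cancel_left]
  have h1 : ∑ l ∈ Finset.range (N + 1), (N.choose l : ℝ) = 2 ^ N := by
    exact_mod_cast Nat.sum_range_choose N
  have h2 : 2 * ∑ l ∈ Finset.range (N + 1), (l : ℝ) * N.choose l = N * 2 ^ N := by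
    have : 2 * ∑ l ∈ Finset.range (N + 1), l * N.choose l = N * 2 ^ N := by
      rw [Nat.sum_range_mul_choose]
      rcases N with _ | N
      · simp
      · rw [Nat.add_sub_cancel, pow_succ]; ring
    exact_mod_cast this
  calc ∑ l ∈ Finset.range (N + 1), (N.choose l : ℝ) * (2 * ((j + l : ℕ) : ℝ) - ((j + N : ℕ) : ℝ))
      = (j - N) * ∑ l ∈ Finset.range (N + 1), (N.choose l : ℝ) +
          2 * ∑ l ∈ Finset.range (N + 1), (l : ℝ) * N.choose l := by
        rw [Finset.mul_sum, Finset.mul_sum, ← Finset.sum_add_distrib]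
        refine Finset.sum_congr rfl fun l _ => ?_
        push_cast
        ring
    _ = j * 2 ^ N := by rw [h1, h2]; ring

theorem fVector_zero_right (n : ℕ) (h : ℕ → ℝ) : fVector n h 0 = h 0 := by
  rw [fVector, Finset.sum_range_succ']
  simp

/-- The functions `m ↦ m.choose k` are linearly independent. -/
theorem eq_zero_of_sum_mul_choose_eq_zero {N : ℕ} {a : ℕ → ℝ}
    (h : ∀ m : ℕ, ∑ k ∈ Finset.range N, a k * m.choose k = 0) {k : ℕ} (hk : k < N) : a k = 0 := by
  induction k using Nat.strong_induction_on with
  | _ k ih =>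
    have := h k
    rw [Finset.sum_eq_single k] at this
    · simpa using this
    · intro j hj hjk
      rcases lt_or_gt_of_ne hjk with hlt | hgt
      · rw [ih j hlt (by simpa using hj), zero_mul]
      · rw [Nat.choose_eq_zero_of_lt hgt]; simp
    · intro hk'
      exact absurd (Finset.mem_range.2 hk) hk'

theorem exists_nonneg_fVector_eigen (n : ℕ) (hn : 2 ≤ n) :
    ∃ h : ℕ → ℝ, (∀ j, 0 ≤ h j) ∧ h 0 = 0 ∧ (∃ j ∈ Finset.range (n + 1), 0 < h j) ∧
      ∀ m : ℕ, ∑ k ∈ Finset.range (n + 1), fVector n h k * (m : ℝ) ^ k =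
        n.factorial * ∑ k ∈ Finset.range (n + 1), fVector n h k * m.choose k := by
  have H (i : Fin (n + 1)) : HasNonnegNumerator n
      (fun m => (m : ℝ) ^ (i : ℕ) * (m + 1) ^ (n - (i : ℕ))) := by
    have := hasNonnegNumerator_pow_mul_pow i (n - i)
    rwa [Nat.add_sub_cancel' (by omega)] at this
  choose c hc hc' hs hm using H
  obtain ⟨g, hg, hg0, hge⟩ := exists_nonneg_eigenvector_of_col_sum_eq
    (M := Matrix.of fun j i : Fin (n + 1) => c i j) (s := n.factorial)
    (fun j i => hc i j) (fun i => by
      rw [← hs i]; exact Fin.sum_univ_eq_sum_range (fun j => c i j) (n + 1))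
  set h : ℕ → ℝ := fun j => if hj : j < n + 1 then g ⟨j, hj⟩ else 0 with hh
  have hgh (i : Fin (n + 1)) : h i = g i := dif_pos i.2
  have hnn : ∀ j, 0 ≤ h j := fun j => by
    simp only [hh]; split_ifs
    · exact hg _
    · exact le_rfl
  have heig : ∀ m : ℕ, ∑ k ∈ Finset.range (n + 1), fVector n h k * (m : ℝ) ^ k =
      n.factorial * ∑ k ∈ Finset.range (n + 1), fVector n h k * m.choose k := by
    intro m
    rw [sum_fVector_mul_pow, sum_fVector_mul_choose, ← Fin.sum_univ_eq_sum_range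
      (fun j => h j * ((m : ℝ) ^ j * (m + 1) ^ (n - j))), ← Fin.sum_univ_eq_sum_range
      (fun j => h j * ((m + n - j).choose n : ℝ)), Finset.mul_sum]
    simp only [hgh]
    have (i : Fin (n + 1)) : (m : ℝ) ^ (i : ℕ) * (m + 1) ^ (n - (i : ℕ)) =
        ∑ j : Fin (n + 1), c i j * (m + n - j).choose n :=
      (hm i m).trans (Fin.sum_univ_eq_sum_range (fun j => c i j * ((m + n - j).choose n : ℝ)) _).symm
    simp only [this, Finset.mul_sum]
    rw [Finset.sum_comm]
    refine Finset.sum_congr rfl fun j _ => ?_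
    have hj := congrFun hge j
    simp only [Matrix.mulVec, dotProduct, Matrix.of_apply, Pi.smul_apply, smul_eq_mul] at hj
    rw [← mul_assoc, ← hj, Finset.sum_mul]
    exact Finset.sum_congr rfl fun i _ => by ring
  refine ⟨h, hnn, ?_, ?_, heig⟩
  · have h0 := heig 0
    simp only [Finset.sum_range_succ', fVector_zero_right] at h0
    simp at h0
    have : (2 : ℝ) ≤ n.factorial := by exact_mod_cast hn.trans n.self_le_factorial
    nlinarith [hnn 0]
  · obtain ⟨i, hi⟩ := Function.ne_iff.1 hg0
    refine ⟨i, Finset.mem_range.2 i.2, ?_⟩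
    rw [hgh]
    exact lt_of_le_of_ne (hg i) (Ne.symm hi)

theorem baryOp_eigenvector_eq_zero {d : ℕ} {u : Fin (d + 1) → ℝ}
    (hu : (baryOp d).mulVec u = ((d + 1).factorial : ℝ) • u) (hlast : u (Fin.last d) = 0) :
    u = 0 := by
  by_contra hne
  obtain ⟨i₀, hi₀⟩ := Function.ne_iff.1 hne
  obtain ⟨i, hi, hmax⟩ := Finset.exists_max_image {i | u i ≠ 0} id ⟨i₀, by simpa using hi₀⟩
  have hi : u i ≠ 0 := by simpa using hi
  have h := congrFun hu i
  simp only [Matrix.mulVec, dotProduct, baryOp, Matrix.of_apply, Pi.smul_apply, smul_eq_mul] at h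
  rw [Finset.sum_eq_single i] at h
  · rw [surjCount_self] at h
    have h := Nat.cast_injective (mul_right_cancel₀ hi h)
    have hid : (i : ℕ) < d := by
      refine lt_of_le_of_ne (Nat.lt_succ_iff.1 i.2) fun hid => hi ?_
      rwa [show i = Fin.last d from Fin.ext hid]
    exact absurd h ((Nat.factorial_lt i.val.succ_pos).2 (by omega)).ne
  · intro k _ hki
    rcases lt_or_gt_of_ne hki with hlt | hgt
    · rw [surjCount_eq_zero_of_lt (by simpa using hlt)]; simp
    · have : u k = 0 := by
        by_contra hk
        exact absurd (hmax k (by simpa using hk)) (not_le.2 hgt)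
      rw [this, mul_zero]
  · simp

theorem baryOp_eigenvector_mul_last {d : ℕ} {u v : Fin (d + 1) → ℝ}
    (hu : (baryOp d).mulVec u = ((d + 1).factorial : ℝ) • u)
    (hv : (baryOp d).mulVec v = ((d + 1).factorial : ℝ) • v) (k : Fin (d + 1)) :
    v k * u (Fin.last d) = u k * v (Fin.last d) := by
  have := baryOp_eigenvector_eq_zero (u := u (Fin.last d) • v - v (Fin.last d) • u)
    (by rw [Matrix.mulVec_sub, Matrix.mulVec_smul, Matrix.mulVec_smul, hu, hv, smul_sub,
      smul_comm, smul_comm (v _)]) (by simp [mul_comm])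
  have := congrFun this k
  simp only [Pi.sub_apply, Pi.smul_apply, smul_eq_mul, Pi.zero_apply] at this
  linarith

theorem exists_rat_baryOp_eigenvector (d : ℕ) :
    ∃ w : Fin (d + 1) → ℚ, w ≠ 0 ∧
      (baryOp d).mulVec (fun i => (w i : ℝ)) = ((d + 1).factorial : ℝ) • fun i => (w i : ℝ) := by
  set B : Matrix (Fin (d + 1)) (Fin (d + 1)) ℚ :=
    Matrix.of fun i k => (surjCount ((k : ℕ) + 1) ((i : ℕ) + 1) : ℚ) with hB
  have hdet : (B - ((d + 1).factorial : ℚ) • (1 : Matrix _ _ ℚ)).det = 0 := by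
    rw [Matrix.det_of_isUpperTriangular]
    · refine Finset.prod_eq_zero (Finset.mem_univ (Fin.last d)) ?_
      simp [hB, surjCount_self]
    · intro i j hij
      have hij : j < i := hij
      simp [hB, surjCount_eq_zero_of_lt (show (j : ℕ) + 1 < i + 1 by simpa using hij), hij.ne']
  obtain ⟨w, hw0, hw⟩ := Matrix.exists_mulVec_eq_zero_iff.2 hdet
  refine ⟨w, hw0, ?_⟩
  rw [Matrix.sub_mulVec, Matrix.smul_mulVec, Matrix.one_mulVec, sub_eq_zero] at hw
  ext i
  have := congrFun hw i
  simp only [Matrix.mulVec, dotProduct, hB, Matrix.of_apply, Pi.smul_apply, smul_eq_mul] at this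
  simp only [Matrix.mulVec, dotProduct, baryOp, Matrix.of_apply, Pi.smul_apply, smul_eq_mul]
  exact_mod_cast this

theorem exists_nonneg_baryOp_eigenvector (d : ℕ) (hd : 1 ≤ d) :
    ∃ u : Fin (d + 1) → ℝ, (∀ i, 0 ≤ u i) ∧
      (baryOp d).mulVec u = ((d + 1).factorial : ℝ) • u ∧
      0 < ∑ k : Fin (d + 1), u k * (2 * ((k : ℕ) + 1) - (d + 1)) := by
  obtain ⟨h, hnn, h0, ⟨j₀, hj₀, hpos⟩, heig⟩ := exists_nonneg_fVector_eigen (d + 1) (by omega)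
  have hf0 : fVector (d + 1) h 0 = 0 := by rw [fVector_zero_right, h0]
  refine ⟨fun k => fVector (d + 1) h (k + 1), fun i => ?_, ?_, ?_⟩
  · refine Finset.sum_nonneg fun j _ => mul_nonneg (hnn j) ?_
    positivity
  · set f := fVector (d + 1) h with hf
    have hsurj (m : ℕ) (k : Fin (d + 1)) : (m : ℝ) ^ ((k : ℕ) + 1) =
        ∑ i ∈ Finset.range (d + 1), (surjCount (k + 1) (i + 1) : ℝ) * m.choose (i + 1) := by
      have h1 := sum_surjCount_mul_choose m (k + 1)
      rw [Finset.sum_range_succ', surjCount_succ_zero, zero_mul, add_zero] at h1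
      rw [← Nat.cast_pow, ← h1]
      push_cast
      refine Finset.sum_subset (fun i hi => by simp at hi ⊢; omega) fun i _ hi => ?_
      rw [surjCount_eq_zero_of_lt (by simpa using hi)]
      simp
    have hz (m : ℕ) : ∑ i ∈ Finset.range (d + 1),
        (∑ k : Fin (d + 1), surjCount (k + 1) (i + 1) * f (k + 1) -
          (d + 1).factorial * f (i + 1)) * m.choose (i + 1) = 0 := by
      have h1 := heig m
      rw [Finset.sum_range_succ', Finset.sum_range_succ' _ (d + 1), hf0,
        ← Fin.sum_univ_eq_sum_range (fun k => f (k + 1) * (m : ℝ) ^ (k + 1))] at h1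
      simp only [zero_mul, add_zero, hsurj, Finset.mul_sum] at h1
      rw [Finset.sum_comm] at h1
      rw [← sub_eq_zero.2 h1, ← Finset.sum_sub_distrib]
      refine Finset.sum_congr rfl fun i _ => ?_
      rw [sub_mul, Finset.sum_mul, mul_assoc]
      congr 1
      exact Finset.sum_congr rfl fun k _ => by ring
    ext i
    have := eq_zero_of_sum_mul_choose_eq_zero (N := d + 2)
      (a := fun j => j.casesOn 0 fun i => ∑ k : Fin (d + 1), surjCount (k + 1) (i + 1) * f (k + 1) -
          (d + 1).factorial * f (i + 1))
      (fun m => by rw [Finset.sum_range_succ']; simpa using hz m) (k := i + 1) (by omega)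
    simpa [Matrix.mulVec, dotProduct, baryOp] using sub_eq_zero.1 this
  · have hS := sum_fVector_mul_two_mul_sub (d + 1) h
    rw [Finset.sum_range_succ', hf0, zero_mul, add_zero, ← Fin.sum_univ_eq_sum_range
      (fun k => fVector (d + 1) h (k + 1) * (2 * ((k + 1 : ℕ) : ℝ) - ((d + 1 : ℕ) : ℝ)))] at hS
    push_cast at hS
    rw [hS]
    refine Finset.sum_pos' (fun j _ => mul_nonneg (hnn j) (by positivity)) ⟨j₀, hj₀, ?_⟩
    have : j₀ ≠ 0 := by
      rintro rfl
      exact hpos.ne' h0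
    positivity

/-- For `d ≥ 1` and `v` the (unique) probability eigenvector with positive
entries of the Barycentric refinement operator to the eigenvalue `(d+1)!`, the
Barycentric limit constant `C_d = ∑_k (k+1)·v_k` is a rational number and
satisfies `(d+1)/2 < C_d < d+1`. -/
theorem baryConstant_rational_and_bounds (d : ℕ) (hd : 1 ≤ d)
    (v : Fin (d + 1) → ℝ)
    (hpos : ∀ i, 0 < v i) (hsum : ∑ i, v i = 1)
    (heig : (baryOp d).mulVec v = ((Nat.factorial (d + 1) : ℝ) • v)) :
    (∃ q : ℚ, (∑ k : Fin (d + 1), ((k : ℕ) + 1) * v k) = (q : ℝ)) ∧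
    ((d : ℝ) + 1) / 2 < ∑ k : Fin (d + 1), ((k : ℕ) + 1) * v k ∧
    (∑ k : Fin (d + 1), ((k : ℕ) + 1) * v k) < (d : ℝ) + 1 := by
  refine ⟨?_, ?_, ?_⟩
  · obtain ⟨w, hw0, hw⟩ := exists_rat_baryOp_eigenvector d
    have hwl : w (Fin.last d) ≠ 0 := fun h => hw0 <| funext fun i => by
      have := congrFun (baryOp_eigenvector_eq_zero hw (by simp [h])) i
      simpa using this
    have hwl' : (w (Fin.last d) : ℝ) ≠ 0 := by exact_mod_cast hwl
    have hvw := baryOp_eigenvector_mul_last hw heig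
    have hlast : w (Fin.last d) = (∑ k, (w k : ℝ)) * v (Fin.last d) := by
      rw [Finset.sum_mul, ← Finset.sum_congr rfl fun k _ => hvw k, ← Finset.sum_mul, hsum, one_mul]
    have hsw : (∑ k, (w k : ℝ)) ≠ 0 := fun h => hwl' (by rw [hlast, h, zero_mul])
    refine ⟨(∑ k : Fin (d + 1), ((k : ℕ) + 1) * w k) / ∑ k, w k, ?_⟩
    push_cast
    rw [eq_div_iff hsw, Finset.sum_mul]
    refine Finset.sum_congr rfl fun k _ => ?_
    rw [mul_assoc]
    congr 1
    refine mul_right_cancel₀ hwl' ?_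
    rw [mul_right_comm, hvw k, mul_assoc, mul_comm (v _), ← hlast]
  · obtain ⟨u, hu0, hu, hupos⟩ := exists_nonneg_baryOp_eigenvector d hd
    have hvu := baryOp_eigenvector_mul_last hu heig
    have key : (∑ k : Fin (d + 1), v k * (2 * ((k : ℕ) + 1) - (d + 1))) * u (Fin.last d) =
        (∑ k : Fin (d + 1), u k * (2 * ((k : ℕ) + 1) - (d + 1))) * v (Fin.last d) := by
      rw [Finset.sum_mul, Finset.sum_mul]
      refine Finset.sum_congr rfl fun k _ => ?_
      rw [mul_right_comm, hvu k, mul_right_comm]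
    have hpos' : 0 < ∑ k : Fin (d + 1), v k * (2 * ((k : ℕ) + 1) - (d + 1)) :=
      pos_of_mul_pos_left (key ▸ mul_pos hupos (hpos _)) (hu0 _)
    have : ∑ k : Fin (d + 1), v k * (2 * ((k : ℕ) + 1) - (d + 1)) =
        2 * (∑ k : Fin (d + 1), ((k : ℕ) + 1) * v k) - (d + 1) * ∑ k, v k := by
      rw [Finset.mul_sum, Finset.mul_sum, ← Finset.sum_sub_distrib]
      exact Finset.sum_congr rfl fun k _ => by ring
    rw [this, hsum] at hpos'
    linarith
  · rw [← mul_one ((d : ℝ) + 1), ← hsum, Finset.mul_sum]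
    refine Finset.sum_lt_sum (fun k _ => ?_) ⟨0, Finset.mem_univ _, ?_⟩
    · have : ((k : ℕ) : ℝ) ≤ d := by exact_mod_cast Nat.lt_succ_iff.1 k.2
      exact mul_le_mul_of_nonneg_right (by linarith) (hpos k).le
    · have : (1 : ℝ) ≤ d := by exact_mod_cast hd
      refine mul_lt_mul_of_pos_right ?_ (hpos 0)
      simp
      linarith
end
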